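/- Suppose t + μ = 0 with t ≥ 2 (so μ = -t ≤ -2), μ ≠ -1, and suppose the degree-regularity equations hold: r = s + k, r = s - 1 + t + c, r = (-μ² - 2μ + s - 1) + (-μ) + d, where k = |X| ≥ 1, c, d are nonnegative integers with d ≤ k - 1. Then μ = -2, t = 2, c = d = k - 1, and a := -μ² - 2μ + s - 1 = s - 1. -/

import Mathlib

/-- The arithmetic core of Theorem 1's proof: the degree-regularity equations force
`μ = -2`, `t = 2`, `c = d = k - 1` and `a = s - 1`. -/
theorem regularity_core (r s t c d k : ℕ) (μ : ℝ) (htμ : (t : ℝ) + μ = 0) (ht : 2 ≤ t)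
    (hμ1 : μ ≠ -1) (hk : 1 ≤ k) (hd : d ≤ k - 1)
    (eq1 : (r : ℝ) = s + k)
    (eq2 : (r : ℝ) = s - 1 + t + c)
    (eq3 : (r : ℝ) = (-μ ^ 2 - 2 * μ + s - 1) + (-μ) + d) :
    μ = -2 ∧ t = 2 ∧ c = k - 1 ∧ d = k - 1 ∧ (-μ ^ 2 - 2 * μ + (s : ℝ) - 1) = s - 1 := by
  have hm : μ = -(t : ℝ) := by linarith
  subst hm
  have hdk : d + 1 ≤ k := by omega
  have hdk' : (d : ℝ) + 1 ≤ k := by exact_mod_cast hdk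
  have ht' : (2 : ℝ) ≤ t := by exact_mod_cast ht
  have h2 : (t : ℝ) = 2 := by nlinarith
  have ht2 : t = 2 := by exact_mod_cast h2
  rw [h2] at eq2 eq3 ⊢
  have hc : (c : ℝ) + 1 = k := by linarith
  have hd2 : (d : ℝ) + 1 = k := by linarith
  have hc' : c + 1 = k := by exact_mod_cast hc
  have hd' : d + 1 = k := by exact_mod_cast hd2
  exact ⟨rfl, ht2, by omega, by omega, by ring⟩
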